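/- Let X ⊆ ℝ, let f : X → X be Borel measurable, and let μ be an f-invariant ergodic Borel probability measure on X. Then the Kolmogorov–Sinai entropy of f satisfies h_μ(f) = lim_{d→∞} h_μ(f, P_d) = sup_{d∈ℕ} h_μ(f, P_d), where P_d is the partition of X into the sets of points realizing the same ordinal pattern of order d. -/

import Mathlib

open MeasureTheory Filter Set Function
open scoped Classical ENNReal Topology

noncomputable section

/-- `ordIdx f d l x` is the inversion number `i_{d,l}(x)`, the `l`-th entry of the
ordinal pattern of order `d` realized by `x`:
`i_{d,l}(x) = #{r ∈ {0,…,l-1} : f^[d-r] x ≤ f^[d-l] x}`. -/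
def ordIdx {X : Set ℝ} (f : X → X) (d l : ℕ) (x : X) : ℕ :=
  ((Finset.range l).filter (fun r => f^[d - r] x ≤ f^[d - l] x)).card

/-- The partition `P_d = {P_i : i ∈ I_d}` of `X` into the sets of points realizing the
same ordinal pattern of order `d`, where an ordinal pattern `i ∈ I_d = ∏_{l=1}^d {0,…,l}`
is encoded as a dependent function `i : ∀ l : Fin d, Fin (l+2)` (so that `i l` is the
entry `i_{l+1} ∈ {0,…,l+1}`). -/
def patPartition {X : Set ℝ} (f : X → X) (d : ℕ) : Finset (Set X) :=
  Finset.image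
    (fun i : (∀ l : Fin d, Fin (l.val + 2)) =>
      {x : X | ∀ l : Fin d, ordIdx f d (l.val + 1) x = (i l).val})
    Finset.univ

/-- `𝒜` is a finite partition of `X` into Borel sets. -/
def IsFinPartition {X : Set ℝ} (𝒜 : Finset (Set X)) : Prop :=
  (∀ A ∈ 𝒜, MeasurableSet A) ∧
  (∀ A ∈ 𝒜, ∀ B ∈ 𝒜, A ≠ B → Disjoint A B) ∧
  ⋃₀ (𝒜 : Set (Set X)) = Set.univ

/-- The Shannon entropy `H(𝒜) = -∑_{A ∈ 𝒜} μ(A) ln μ(A)` of a finite partition `𝒜`. -/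
def partEntropy {X : Set ℝ} (μ : Measure X) (𝒜 : Finset (Set X)) : ℝ :=
  ∑ A ∈ 𝒜, Real.negMulLog (μ A).toReal

/-- The common refinement `⋁_{j=0}^{n-1} f^{-∘j}(𝒜)`, i.e. the partition of `X` into the
nonempty intersections `⋂_{j<n} f^{-∘j}(A_j)` with `A_j ∈ 𝒜`; it is the (unique up to
empty sets) partition generating the σ-algebra `⋁_{j=0}^{n-1} f^{-∘j}(𝒜)`. -/
def dynRefine {X : Set ℝ} (f : X → X) (𝒜 : Finset (Set X)) : ℕ → Finset (Set X)
  | 0 => {Set.univ}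
  | n + 1 =>
      ((dynRefine f 𝒜 n) ×ˢ (𝒜.image fun A => f^[n] ⁻¹' A)).image fun p => p.1 ∩ p.2

/-- `h_μ(f,𝒜) = lim_{n→∞} (1/n) H(⋁_{j=0}^{n-1} f^{-∘j}(𝒜))` (the limit exists and is
here expressed as a `limsup`). -/
def dynEntropy {X : Set ℝ} (μ : Measure X) (f : X → X) (𝒜 : Finset (Set X)) : ℝ :=
  Filter.limsup (fun n : ℕ => partEntropy μ (dynRefine f 𝒜 n) / n) Filter.atTop

/-- The Kolmogorov-Sinai entropy `h_μ(f) = sup {h_μ(f,𝒜) : 𝒜 finite Borel partition}`,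
as an extended nonnegative real. -/
def ksEntropy {X : Set ℝ} (μ : Measure X) (f : X → X) : ℝ≥0∞ :=
  ⨆ (𝒜 : Finset (Set X)) (_ : IsFinPartition 𝒜), ENNReal.ofReal (dynEntropy μ f 𝒜)

/-- The permutation entropy `h*_μ(f) = limsup_{d→∞} (1/d) H(P_d)`, as an extended
nonnegative real. -/
def permEntropy {X : Set ℝ} (μ : Measure X) (f : X → X) : ℝ≥0∞ :=
  Filter.limsup
    (fun d : ℕ => ENNReal.ofReal (partEntropy μ (patPartition f d)) / (d : ℝ≥0∞))
    Filter.atTop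

section FiniteValued

variable {Ω : Type*} [MeasurableSpace Ω] {ι κ τ : Type*}

/-- The Shannon entropy of the partition of `Ω` into the fibres of a finite-valued map. -/
def fibreEntropy [Fintype ι] (μ : Measure Ω) (ξ : Ω → ι) : ℝ :=
  ∑ i, Real.negMulLog (μ.real (ξ ⁻¹' {i}))

lemma negMulLog_add_le_of_marginals {q r c s : ℝ} (hq : 0 ≤ q) (hqr : q ≤ r) (hqc : q ≤ c)
    (hrs : r ≤ s) :
    Real.negMulLog q - q * Real.log s ≤
      -(q * Real.log r) - q * Real.log c + (r * c / s - q) := by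
  rcases hq.eq_or_lt with rfl | hq0
  · have : 0 ≤ r * c / s := div_nonneg (mul_nonneg hqr hqc) (hqr.trans hrs)
    simpa using this
  · have hr : 0 < r := hq0.trans_le hqr
    have hc : 0 < c := hq0.trans_le hqc
    have hs : 0 < s := hr.trans_le hrs
    have h := Real.log_le_sub_one_of_pos (x := r * c / (s * q)) (by positivity)
    rw [Real.log_div (by positivity) (by positivity), Real.log_mul hr.ne' hc.ne',
      Real.log_mul hs.ne' hq0.ne'] at h
    have h2 := mul_le_mul_of_nonneg_left h hq
    have h3 : q * (r * c / (s * q) - 1) = r * c / s - q := by field_simp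
    rw [h3] at h2
    simp only [Real.negMulLog]
    linarith

lemma negMulLog_sum_eq [Fintype ι] (q : ι → ℝ) :
    Real.negMulLog (∑ i, q i) = ∑ i, -(q i * Real.log (∑ i, q i)) := by
  rw [Real.negMulLog, neg_mul, Finset.sum_mul, Finset.sum_neg_distrib]

lemma sum_negMulLog_add_le [Fintype ι] [Fintype κ] (q : ι → κ → ℝ) (hq : ∀ i j, 0 ≤ q i j) :
    ∑ i, ∑ j, Real.negMulLog (q i j) + Real.negMulLog (∑ i, ∑ j, q i j) ≤
      ∑ i, Real.negMulLog (∑ j, q i j) + ∑ j, Real.negMulLog (∑ i, q i j) := by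
  set s := ∑ i, ∑ j, q i j with hs
  have hs' : s = ∑ j, ∑ i, q i j := Finset.sum_comm
  have key : ∀ i j, Real.negMulLog (q i j) - q i j * Real.log s ≤
      -(q i j * Real.log (∑ j, q i j)) - q i j * Real.log (∑ i, q i j) +
        ((∑ j, q i j) * (∑ i, q i j) / s - q i j) := fun i j =>
    negMulLog_add_le_of_marginals (hq i j)
      (Finset.single_le_sum (f := fun j => q i j) (fun j _ => hq i j) (Finset.mem_univ j))
      (Finset.single_le_sum (f := fun i => q i j) (fun i _ => hq i j) (Finset.mem_univ i))
      (Finset.single_le_sum (f := fun i => ∑ j, q i j)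
        (fun i _ => Finset.sum_nonneg fun j _ => hq i j) (Finset.mem_univ i))
  have h := Finset.sum_le_sum fun i (_ : i ∈ Finset.univ) =>
    Finset.sum_le_sum fun j (_ : j ∈ Finset.univ) => key i j
  simp only [Finset.sum_add_distrib, Finset.sum_sub_distrib] at h
  have e1 : ∑ i, Real.negMulLog (∑ j, q i j) = ∑ i, ∑ j, -(q i j * Real.log (∑ j, q i j)) :=
    Finset.sum_congr rfl fun i _ => negMulLog_sum_eq _
  have e2 : ∑ j, Real.negMulLog (∑ i, q i j) =
      - ∑ i, ∑ j, q i j * Real.log (∑ i, q i j) := by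
    rw [Finset.sum_comm, ← Finset.sum_neg_distrib]
    exact Finset.sum_congr rfl fun j _ => by rw [negMulLog_sum_eq, Finset.sum_neg_distrib]
  have e3 : ∑ i, ∑ j, (∑ j, q i j) * (∑ i, q i j) / s = s := by
    simp_rw [← Finset.sum_div, ← Finset.mul_sum, ← Finset.sum_mul, ← hs', ← hs]
    exact mul_self_div_self s
  have e4 : Real.negMulLog s = -∑ i, ∑ j, q i j * Real.log s := by
    simp_rw [← Finset.sum_mul, ← hs, Real.negMulLog, neg_mul]
  linarith

lemma negMulLog_sum_le [Fintype ι] (q : ι → ℝ) (hq : ∀ i, 0 ≤ q i) :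
    Real.negMulLog (∑ i, q i) ≤ ∑ i, Real.negMulLog (q i) := by
  rw [negMulLog_sum_eq]
  refine Finset.sum_le_sum fun i _ => ?_
  rw [Real.negMulLog, neg_mul, neg_le_neg_iff]
  rcases (hq i).eq_or_lt with h | h
  · simp [← h]
  · exact mul_le_mul_of_nonneg_left (Real.log_le_log h
      (Finset.single_le_sum (fun j _ => hq j) (Finset.mem_univ i))) (hq i)

variable [MeasurableSpace ι] [MeasurableSingletonClass ι] [MeasurableSpace κ]
  [MeasurableSingletonClass κ] [MeasurableSpace τ] [MeasurableSingletonClass τ]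
  {μ : Measure Ω} [IsProbabilityMeasure μ]

omit [MeasurableSpace κ] [MeasurableSingletonClass κ] in
lemma measureReal_fibre_eq_sum [Fintype ι] {ξ : Ω → ι} (hξ : Measurable ξ) (η : Ω → κ) (k : κ) :
    μ.real (η ⁻¹' {k}) = ∑ i, μ.real ((fun x => (ξ x, η x)) ⁻¹' {(i, k)}) := by
  have h := sum_measureReal_preimage_singleton (μ := μ.restrict (η ⁻¹' {k})) (f := ξ) Finset.univ
    (fun y _ => hξ (measurableSet_singleton y))
  simp only [Finset.coe_univ, preimage_univ, measureReal_restrict_apply_univ] at h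
  rw [← h]
  refine Finset.sum_congr rfl fun i _ => ?_
  rw [measureReal_restrict_apply (hξ (measurableSet_singleton i))]
  congr 1
  ext x
  simp

omit [MeasurableSpace τ] [MeasurableSingletonClass τ] in
/-- Strong subadditivity of entropy. -/
lemma fibreEntropy_add_le [Fintype ι] [Fintype κ] [Fintype τ] {ξ : Ω → ι} {η : Ω → κ}
    {ζ : Ω → τ} (hξ : Measurable ξ) (hη : Measurable η) :
    fibreEntropy μ (fun x => (ξ x, η x, ζ x)) + fibreEntropy μ ζ ≤
      fibreEntropy μ (fun x => (ξ x, ζ x)) + fibreEntropy μ (fun x => (η x, ζ x)) := by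
  set p : τ → ι → κ → ℝ := fun k i j => μ.real ((fun x => (ξ x, η x, ζ x)) ⁻¹' {(i, j, k)})
  have h1 : ∀ j k, μ.real ((fun x => (η x, ζ x)) ⁻¹' {(j, k)}) = ∑ i, p k i j := fun j k =>
    measureReal_fibre_eq_sum hξ _ _
  have h2 : ∀ i k, μ.real ((fun x => (ξ x, ζ x)) ⁻¹' {(i, k)}) = ∑ j, p k i j := fun i k => by
    rw [measureReal_fibre_eq_sum hη]
    refine Finset.sum_congr rfl fun j _ => ?_
    simp only [p]
    congr 1
    ext x
    simp only [mem_preimage, mem_singleton_iff, Prod.mk.injEq]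
    tauto
  have h3 : ∀ k, μ.real (ζ ⁻¹' {k}) = ∑ i, ∑ j, p k i j := fun k => by
    rw [measureReal_fibre_eq_sum hξ]
    exact Finset.sum_congr rfl fun i _ => h2 i k
  have h4 : ∀ i j k, μ.real ((fun x => (ξ x, η x, ζ x)) ⁻¹' {(i, j, k)}) = p k i j :=
    fun _ _ _ => rfl
  have e1 : fibreEntropy μ (fun x => (ξ x, η x, ζ x)) =
      ∑ k, ∑ i, ∑ j, Real.negMulLog (p k i j) := by
    simp only [fibreEntropy, Fintype.sum_prod_type, h4]
    rw [Finset.sum_comm]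
    simp_rw [Finset.sum_comm (s := (Finset.univ : Finset τ)) (t := (Finset.univ : Finset ι))]
    rw [Finset.sum_comm]
    refine Finset.sum_congr rfl fun i _ => ?_
    rw [Finset.sum_comm]
  have e2 : fibreEntropy μ (fun x => (ξ x, ζ x)) =
      ∑ k, ∑ i, Real.negMulLog (∑ j, p k i j) := by
    simp only [fibreEntropy, Fintype.sum_prod_type, h2]
    rw [Finset.sum_comm]
  have e3 : fibreEntropy μ (fun x => (η x, ζ x)) =
      ∑ k, ∑ j, Real.negMulLog (∑ i, p k i j) := by
    simp only [fibreEntropy, Fintype.sum_prod_type, h1]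
    rw [Finset.sum_comm]
  have e4 : fibreEntropy μ ζ = ∑ k, Real.negMulLog (∑ i, ∑ j, p k i j) := by
    simp only [fibreEntropy, h3]
  rw [e1, e2, e3, e4, ← Finset.sum_add_distrib, ← Finset.sum_add_distrib]
  exact Finset.sum_le_sum fun k _ => sum_negMulLog_add_le _ fun _ _ => measureReal_nonneg

omit [MeasurableSpace κ] [MeasurableSingletonClass κ] in
lemma fibreEntropy_le_of_factor [Fintype ι] [Fintype κ] {ξ : Ω → ι} {η : Ω → κ}
    (hξ : Measurable ξ) (h : ∀ x y, ξ x = ξ y → η x = η y) :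
    fibreEntropy μ η ≤ fibreEntropy μ ξ := by
  have key : ∀ i, ∑ j, Real.negMulLog (μ.real ((fun x => (ξ x, η x)) ⁻¹' {(i, j)})) ≤
      Real.negMulLog (μ.real (ξ ⁻¹' {i})) := fun i => by
    by_cases hi : ∃ x, ξ x = i
    · obtain ⟨x, rfl⟩ := hi
      rw [Finset.sum_eq_single (η x)]
      · apply le_of_eq
        congr 2
        ext y
        simpa using fun hy => h _ _ hy
      · intro j _ hj
        have : (fun x => (ξ x, η x)) ⁻¹' {(ξ x, j)} = ∅ := by
          ext y
          simp only [mem_preimage, mem_singleton_iff, Prod.mk.injEq, mem_empty_iff_false, iff_false]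
          rintro ⟨hy, rfl⟩
          exact hj (h _ _ hy)
        simp [this]
      · simp
    · have h0 : ξ ⁻¹' {i} = ∅ := by
        ext y
        simpa using fun hy => hi ⟨y, hy⟩
      have : ∀ j, (fun x => (ξ x, η x)) ⁻¹' {(i, j)} = ∅ := fun j => by
        ext y
        simpa using fun hy => (hi ⟨y, hy⟩).elim
      simp [this, h0]
  refine le_trans ?_ (Finset.sum_le_sum fun i _ => key i)
  rw [Finset.sum_comm]
  refine Finset.sum_le_sum fun j _ => ?_
  rw [measureReal_fibre_eq_sum hξ]
  exact negMulLog_sum_le _ fun _ => measureReal_nonneg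

omit [MeasurableSpace ι] [MeasurableSingletonClass ι] in
lemma fibreEntropy_nonneg [Fintype ι] (ξ : Ω → ι) : 0 ≤ fibreEntropy μ ξ :=
  Finset.sum_nonneg fun _ _ => Real.negMulLog_nonneg measureReal_nonneg measureReal_le_one

omit [IsProbabilityMeasure μ] in
lemma fibreEntropy_comp [Fintype ι] {ξ : Ω → ι} (hξ : Measurable ξ) {f : Ω → Ω}
    (hf : MeasurePreserving f μ μ) : fibreEntropy μ (fun x => ξ (f x)) = fibreEntropy μ ξ := by
  refine Finset.sum_congr rfl fun i _ => ?_
  congr 1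
  exact hf.measureReal_preimage (hξ (measurableSet_singleton i)).nullMeasurableSet

/-- The joint name of length `n` of the orbit of a point. -/
def itinerary (f : Ω → Ω) (ξ : Ω → ι) (n : ℕ) (x : Ω) : Fin n → ι := fun j => ξ (f^[j] x)

omit [MeasurableSingletonClass ι] in
lemma measurable_itinerary {f : Ω → Ω} (hf : Measurable f) {ξ : Ω → ι} (hξ : Measurable ξ) (n : ℕ) :
    Measurable (itinerary f ξ n) :=
  measurable_pi_lambda _ fun j => hξ.comp (hf.iterate j)

omit [MeasurableSpace Ω] [MeasurableSpace ι] [MeasurableSingletonClass ι] in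
lemma itinerary_succ_eq_iff {f : Ω → Ω} {ξ : Ω → ι} {n : ℕ} {x y : Ω} :
    itinerary f ξ (n + 1) x = itinerary f ξ (n + 1) y ↔
      itinerary f ξ n x = itinerary f ξ n y ∧ ξ (f^[n] x) = ξ (f^[n] y) := by
  simp only [itinerary, funext_iff, Fin.forall_fin_succ', Fin.val_castSucc, Fin.val_last]

omit [MeasurableSpace τ] [MeasurableSingletonClass τ] in
lemma fibreEntropy_pair_itinerary_le [Fintype ι] [Fintype κ] {f : Ω → Ω}
    (hf : MeasurePreserving f μ μ) {ξ : Ω → ι} {η : Ω → κ} (hξ : Measurable ξ) (hη : Measurable η)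
    (n : ℕ) :
    fibreEntropy μ (fun x => (itinerary f ξ n x, itinerary f η n x)) ≤
      fibreEntropy μ (itinerary f η n) +
        n * (fibreEntropy μ (fun x => (ξ x, η x)) - fibreEntropy μ η) := by
  induction n with
  | zero =>
    simpa using fibreEntropy_le_of_factor (measurable_itinerary hf.measurable hη 0)
      (fun x y _ => Subsingleton.elim _ _)
  | succ n ih =>
    have hξn := measurable_itinerary hf.measurable hξ n
    have hηn := measurable_itinerary hf.measurable hη n
    have hηn' := measurable_itinerary hf.measurable hη (n + 1)
    have hξs : Measurable fun x => ξ (f^[n] x) := hξ.comp (hf.measurable.iterate n)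
    have hηs : Measurable fun x => η (f^[n] x) := hη.comp (hf.measurable.iterate n)
    have e1 := fibreEntropy_comp (ξ := fun x => (ξ x, η x)) (hξ.prodMk hη) (hf.iterate n)
    have e2 := fibreEntropy_comp hη (hf.iterate n)
    have s1 := fibreEntropy_add_le (μ := μ) (ζ := itinerary f η (n + 1)) hξn hξs
    have s2 := fibreEntropy_add_le (μ := μ) (ζ := itinerary f η n) hξn hηs
    have s3 := fibreEntropy_add_le (μ := μ) (ζ := fun x => η (f^[n] x)) hξs hηn
    have f1 : fibreEntropy μ (fun x => (itinerary f ξ (n + 1) x, itinerary f η (n + 1) x)) ≤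
        fibreEntropy μ (fun x => (itinerary f ξ n x, ξ (f^[n] x), itinerary f η (n + 1) x)) :=
      fibreEntropy_le_of_factor (hξn.prodMk (hξs.prodMk hηn')) fun x y => by
        simp only [Prod.mk.injEq, itinerary_succ_eq_iff]; tauto
    have f2 : fibreEntropy μ (fun x => (itinerary f ξ n x, itinerary f η (n + 1) x)) ≤
        fibreEntropy μ (fun x => (itinerary f ξ n x, η (f^[n] x), itinerary f η n x)) :=
      fibreEntropy_le_of_factor (hξn.prodMk (hηs.prodMk hηn)) fun x y => by
        simp only [Prod.mk.injEq, itinerary_succ_eq_iff]; tauto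
    have f3 : fibreEntropy μ (fun x => (η (f^[n] x), itinerary f η n x)) ≤
        fibreEntropy μ (itinerary f η (n + 1)) :=
      fibreEntropy_le_of_factor hηn' fun x y => by
        simp only [Prod.mk.injEq, itinerary_succ_eq_iff]; tauto
    have f4 : fibreEntropy μ (fun x => (ξ (f^[n] x), itinerary f η (n + 1) x)) ≤
        fibreEntropy μ (fun x => (ξ (f^[n] x), itinerary f η n x, η (f^[n] x))) :=
      fibreEntropy_le_of_factor (hξs.prodMk (hηn.prodMk hηs)) fun x y => by
        simp only [Prod.mk.injEq, itinerary_succ_eq_iff]; tauto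
    have f5 : fibreEntropy μ (fun x => (itinerary f η n x, η (f^[n] x))) ≤
        fibreEntropy μ (itinerary f η (n + 1)) :=
      fibreEntropy_le_of_factor hηn' fun x y => by
        simp only [Prod.mk.injEq, itinerary_succ_eq_iff]; tauto
    push_cast
    linarith

lemma fibreEntropy_itinerary_le_add [Fintype ι] [Fintype κ] {f : Ω → Ω}
    (hf : MeasurePreserving f μ μ) {ξ : Ω → ι} {η : Ω → κ} (hξ : Measurable ξ) (hη : Measurable η)
    (n : ℕ) :
    fibreEntropy μ (itinerary f ξ n) ≤ fibreEntropy μ (itinerary f η n) +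
        n * (fibreEntropy μ (fun x => (ξ x, η x)) - fibreEntropy μ η) := by
  refine le_trans ?_ (fibreEntropy_pair_itinerary_le hf hξ hη n)
  exact fibreEntropy_le_of_factor ((measurable_itinerary hf.measurable hξ n).prodMk
    (measurable_itinerary hf.measurable hη n)) (by simp +contextual)

omit [MeasurableSpace ι] [MeasurableSingletonClass ι] in
lemma fibreEntropy_of_subsingleton [Fintype ι] [Subsingleton ι] (ξ : Ω → ι) :
    fibreEntropy μ ξ = 0 := by
  refine Finset.sum_eq_zero fun i _ => ?_
  have : ξ ⁻¹' {i} = univ := by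
    ext x
    simpa using Subsingleton.elim _ _
  simp [this]

lemma fibreEntropy_itinerary_le [Fintype ι] {f : Ω → Ω}
    (hf : MeasurePreserving f μ μ) {ξ : Ω → ι} (hξ : Measurable ξ) (n : ℕ) :
    fibreEntropy μ (itinerary f ξ n) ≤ n * fibreEntropy μ ξ := by
  have h := fibreEntropy_itinerary_le_add hf hξ (measurable_const (a := ())) n
  rw [fibreEntropy_of_subsingleton (itinerary f (fun _ => ()) n),
    fibreEntropy_of_subsingleton (fun _ : Ω => ()), zero_add, sub_zero] at h
  refine h.trans (mul_le_mul_of_nonneg_left ?_ n.cast_nonneg)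
  exact fibreEntropy_le_of_factor hξ (by simp +contextual)

lemma exists_fibreEntropy_pair_sub_lt [Fintype ι]
    {ξ : Ω → ι} (hξ : Measurable ξ) {ε : ℝ} (hε : 0 < ε) :
    ∃ δ > 0, ∀ ζ : Ω → ι, μ.real {x | ξ x ≠ ζ x} < δ →
      fibreEntropy μ (fun x => (ξ x, ζ x)) - fibreEntropy μ ζ < ε := by
  set l : Filter (Ω → ι) := comap (fun ζ => μ.real {x | ξ x ≠ ζ x}) (𝓝 0)
  have hl : Tendsto (fun ζ => μ.real {x | ξ x ≠ ζ x}) l (𝓝 0) := tendsto_comap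
  have hle : ∀ (A B D : Set Ω), A ⊆ B ∪ D → B ⊆ A ∪ D → |μ.real A - μ.real B| ≤ μ.real D := by
    intro A B D h1 h2
    have h1' := (measureReal_mono (μ := μ) h1).trans (measureReal_union_le _ _)
    have h2' := (measureReal_mono (μ := μ) h2).trans (measureReal_union_le _ _)
    rw [abs_le]
    constructor <;> linarith
  have ht : ∀ (A : (Ω → ι) → Set Ω) (B : Set Ω),
      (∀ ζ, A ζ ⊆ B ∪ {x | ξ x ≠ ζ x}) → (∀ ζ, B ⊆ A ζ ∪ {x | ξ x ≠ ζ x}) →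
      Tendsto (fun ζ => Real.negMulLog (μ.real (A ζ))) l (𝓝 (Real.negMulLog (μ.real B))) := by
    intro A B h1 h2
    refine (Real.continuous_negMulLog.tendsto _).comp ?_
    rw [tendsto_iff_dist_tendsto_zero]
    exact squeeze_zero (fun _ => dist_nonneg) (fun ζ => hle _ _ _ (h1 ζ) (h2 ζ)) hl
  have h1 : Tendsto (fun ζ => fibreEntropy μ (fun x => (ξ x, ζ x))) l
      (𝓝 (fibreEntropy μ (fun x => (ξ x, ξ x)))) := by
    refine tendsto_finsetSum _ fun p _ => ht _ _ ?_ ?_ <;>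
    · intro ζ x
      by_cases h : ξ x = ζ x <;> simp [h]
  have h2 : Tendsto (fun ζ => fibreEntropy μ ζ) l (𝓝 (fibreEntropy μ ξ)) := by
    refine tendsto_finsetSum _ fun p _ => ht _ _ ?_ ?_ <;>
    · intro ζ x
      by_cases h : ξ x = ζ x <;> simp [h]
  have h3 : fibreEntropy μ (fun x => (ξ x, ξ x)) - fibreEntropy μ ξ ≤ 0 :=
    sub_nonpos.2 (fibreEntropy_le_of_factor hξ (by simp +contextual))
  have h4 := (h1.sub h2).eventually_lt_const (h3.trans_lt hε)
  obtain ⟨s, hs, hs'⟩ := mem_comap.1 h4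
  obtain ⟨δ, hδ, hball⟩ := Metric.mem_nhds_iff.1 hs
  refine ⟨δ, hδ, fun ζ hζ => hs' (hball ?_)⟩
  simpa [abs_of_nonneg measureReal_nonneg] using hζ

end FiniteValued

section Partitions

variable {X : Set ℝ} {ι κ : Type*}

/-- The nonempty members of `𝒜` are exactly the nonempty fibres of `ξ`. -/
structure IsFibrePartition (𝒜 : Finset (Set X)) (ξ : X → ι) : Prop where
  eq_fibre : ∀ A ∈ 𝒜, ∀ x ∈ A, A = ξ ⁻¹' {ξ x}
  fibre_mem : ∀ x, ξ ⁻¹' {ξ x} ∈ 𝒜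

lemma IsFibrePartition.partEntropy_eq [Fintype ι] {𝒜 : Finset (Set X)} {ξ : X → ι}
    (h : IsFibrePartition 𝒜 ξ) (μ : Measure X) : partEntropy μ 𝒜 = fibreEntropy μ ξ := by
  have h1 : fibreEntropy μ ξ = ∑ i ∈ Finset.univ.filter (fun i => (ξ ⁻¹' {i}).Nonempty),
      Real.negMulLog (μ.real (ξ ⁻¹' {i})) := by
    refine (Finset.sum_filter_of_ne fun i _ hi => ?_).symm
    contrapose! hi
    simp [hi]
  rw [h1, partEntropy]
  symm
  refine Finset.sum_of_injOn (fun i => ξ ⁻¹' {i}) ?_ ?_ ?_ fun _ _ => rfl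
  · intro i hi j _ hij
    obtain ⟨x, hx⟩ := (Finset.mem_filter.1 hi).2
    have hx' : x ∈ ξ ⁻¹' {j} := (show ξ ⁻¹' {i} = ξ ⁻¹' {j} from hij) ▸ hx
    exact hx.symm.trans hx'
  · intro i hi
    obtain ⟨x, rfl⟩ := (Finset.mem_filter.1 hi).2
    exact h.fibre_mem x
  · intro A hA hA'
    rcases A.eq_empty_or_nonempty with rfl | ⟨x, hx⟩
    · simp
    · refine (hA' ⟨ξ x, ?_, (h.eq_fibre A hA x hx).symm⟩).elim
      simpa using ⟨x, rfl⟩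

lemma IsFibrePartition.dynRefine {𝒜 : Finset (Set X)} {ξ : X → ι} (h : IsFibrePartition 𝒜 ξ)
    (f : X → X) (n : ℕ) : IsFibrePartition (dynRefine f 𝒜 n) (itinerary f ξ n) := by
  induction n with
  | zero =>
    have h0 : ∀ x : X, itinerary f ξ 0 ⁻¹' {itinerary f ξ 0 x} = univ := fun x => by
      ext y
      simpa using Subsingleton.elim _ _
    constructor
    · intro A hA x _
      rw [h0]
      simpa [_root_.dynRefine] using hA
    · intro x
      rw [h0]
      simp [_root_.dynRefine]
  | succ n ih =>
    have hs : ∀ x, itinerary f ξ (n + 1) ⁻¹' {itinerary f ξ (n + 1) x} =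
        itinerary f ξ n ⁻¹' {itinerary f ξ n x} ∩ f^[n] ⁻¹' (ξ ⁻¹' {ξ (f^[n] x)}) := fun x => by
      ext y
      simp [itinerary_succ_eq_iff]
    constructor
    · intro A hA x hx
      simp only [_root_.dynRefine, Finset.mem_image, Finset.mem_product, Prod.exists] at hA
      obtain ⟨B, C, ⟨hB, D, hD, rfl⟩, rfl⟩ := hA
      rw [hs, ← ih.eq_fibre B hB x hx.1, ← h.eq_fibre D hD _ hx.2]
    · intro x
      rw [hs]
      simp only [_root_.dynRefine, Finset.mem_image, Finset.mem_product, Prod.exists]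
      exact ⟨_, _, ⟨ih.fibre_mem x, _, h.fibre_mem (f^[n] x), rfl⟩, rfl⟩

lemma IsFibrePartition.dynEntropy_eq [Fintype ι] {𝒜 : Finset (Set X)} {ξ : X → ι}
    (h : IsFibrePartition 𝒜 ξ) (μ : Measure X) (f : X → X) :
    dynEntropy μ f 𝒜 = limsup (fun n : ℕ => fibreEntropy μ (itinerary f ξ n) / n) atTop := by
  simp only [dynEntropy, (h.dynRefine f _).partEntropy_eq]

lemma IsFibrePartition.isFinPartition [Fintype ι] [MeasurableSpace ι] [MeasurableSingletonClass ι]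
    {𝒜 : Finset (Set X)} {ξ : X → ι} (h : IsFibrePartition 𝒜 ξ) (hξ : Measurable ξ) :
    IsFinPartition 𝒜 := by
  refine ⟨fun A hA => ?_, fun A hA B hB hAB => ?_, ?_⟩
  · rcases A.eq_empty_or_nonempty with rfl | ⟨x, hx⟩
    · exact MeasurableSet.empty
    · rw [h.eq_fibre A hA x hx]
      exact hξ (measurableSet_singleton _)
  · rw [Set.disjoint_left]
    intro x hxA hxB
    exact hAB ((h.eq_fibre A hA x hxA).trans (h.eq_fibre B hB x hxB).symm)
  · exact eq_univ_of_forall fun x => ⟨_, h.fibre_mem x, rfl⟩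

lemma IsFinPartition.exists_isFibrePartition {𝒜 : Finset (Set X)} (h : IsFinPartition 𝒜) :
    ∃ ξ : X → Fin 𝒜.card, Measurable ξ ∧ IsFibrePartition 𝒜 ξ := by
  obtain ⟨hm, hd, hc⟩ := h
  have hex : ∀ x : X, ∃ A : 𝒜, x ∈ A.1 := fun x => by
    obtain ⟨A, hA, hx⟩ := mem_sUnion.1 (hc ▸ mem_univ x)
    exact ⟨⟨A, hA⟩, hx⟩
  choose P hP using hex
  have huniq : ∀ x (A : 𝒜), x ∈ A.1 → A = P x := fun x A hx => by
    by_contra hne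
    exact Set.disjoint_left.1 (hd _ A.2 _ (P x).2 fun e => hne (Subtype.ext e)) hx (hP x)
  have hfib : ∀ x, (fun y => 𝒜.equivFin (P y)) ⁻¹' {𝒜.equivFin (P x)} = (P x).1 := fun x => by
    ext y
    simp only [mem_preimage, mem_singleton_iff, EmbeddingLike.apply_eq_iff_eq]
    exact ⟨fun e => e ▸ hP y, fun hy => (huniq y _ hy).symm⟩
  refine ⟨fun x => 𝒜.equivFin (P x), measurable_to_countable fun x => ?_, fun A hA x hx => ?_,
    fun x => ?_⟩
  · rw [hfib]
    exact hm _ (P x).2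
  · rw [hfib, ← huniq x ⟨A, hA⟩ hx]
  · rw [hfib]
    exact (P x).2

lemma dynEntropy_le_add [Fintype ι] [Fintype κ] [MeasurableSpace ι] [MeasurableSingletonClass ι]
    [MeasurableSpace κ] [MeasurableSingletonClass κ] {μ : Measure X} [IsProbabilityMeasure μ]
    {f : X → X} (hf : MeasurePreserving f μ μ) {𝒜 ℬ : Finset (Set X)} {ξ : X → ι} {η : X → κ}
    (hξ : Measurable ξ) (hη : Measurable η) (h𝒜 : IsFibrePartition 𝒜 ξ)
    (hℬ : IsFibrePartition ℬ η) :
    dynEntropy μ f 𝒜 ≤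
      dynEntropy μ f ℬ + (fibreEntropy μ (fun x => (ξ x, η x)) - fibreEntropy μ η) := by
  set c := fibreEntropy μ (fun x => (ξ x, η x)) - fibreEntropy μ η
  have hnn : ∀ n : ℕ, 0 ≤ fibreEntropy μ (itinerary f ξ n) / n := fun n =>
    div_nonneg (fibreEntropy_nonneg _) n.cast_nonneg
  have hbdd : IsBoundedUnder (· ≤ ·) atTop
      (fun n : ℕ => fibreEntropy μ (itinerary f η n) / n) := by
    refine isBoundedUnder_of ⟨fibreEntropy μ η, fun n => ?_⟩
    refine div_le_of_le_mul₀ n.cast_nonneg (fibreEntropy_nonneg _) ?_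
    rw [mul_comm]
    exact fibreEntropy_itinerary_le hf hη n
  rw [h𝒜.dynEntropy_eq, hℬ.dynEntropy_eq, ← sub_le_iff_le_add]
  refine le_of_forall_gt fun b hb => ?_
  obtain ⟨b', hb', hbb⟩ := exists_between hb
  have hev := eventually_lt_of_limsup_lt hb' hbdd
  suffices limsup (fun n : ℕ => fibreEntropy μ (itinerary f ξ n) / n) atTop ≤ b' + c by linarith
  refine limsup_le_of_le (isCoboundedUnder_le_of_le atTop (x := 0) hnn) ?_
  filter_upwards [hev, eventually_gt_atTop 0] with n hn hn0
  have hn0' : (0 : ℝ) < n := Nat.cast_pos.2 hn0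
  have h := fibreEntropy_itinerary_le_add hf hξ hη n
  rw [div_lt_iff₀ hn0'] at hn
  rw [div_le_iff₀ hn0']
  linarith

lemma fibreEntropy_pair_sub_le_of_factor [Fintype ι] [Fintype κ] [MeasurableSpace ι]
    [MeasurableSingletonClass ι] [MeasurableSpace κ] [MeasurableSingletonClass κ] {μ : Measure X}
    [IsProbabilityMeasure μ] {ξ ζ : X → ι} {η : X → κ} (hξ : Measurable ξ) (hη : Measurable η)
    (hζ : ∀ x y, η x = η y → ζ x = ζ y) :
    fibreEntropy μ (fun x => (ξ x, η x)) - fibreEntropy μ η ≤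
      fibreEntropy μ (fun x => (ξ x, ζ x)) - fibreEntropy μ ζ := by
  have hζm : Measurable ζ := by
    refine measurable_to_countable fun x => ?_
    have : ζ ⁻¹' {ζ x} = η ⁻¹' {k | ∃ y, η y = k ∧ ζ y = ζ x} := by
      ext y
      simp only [mem_preimage, mem_singleton_iff, mem_ofPred_eq]
      exact ⟨fun h => ⟨y, rfl, h⟩, fun ⟨z, h1, h2⟩ => (hζ _ _ h1).symm.trans h2⟩
    rw [this]
    exact hη (Set.toFinite _).measurableSet
  have h1 := fibreEntropy_add_le (μ := μ) (ζ := ζ) hξ hη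
  have h2 : fibreEntropy μ (fun x => (η x, ζ x)) ≤ fibreEntropy μ η :=
    fibreEntropy_le_of_factor hη fun x y h => by simp [h, hζ x y h]
  have h3 : fibreEntropy μ (fun x => (ξ x, η x)) ≤ fibreEntropy μ (fun x => (ξ x, η x, ζ x)) :=
    fibreEntropy_le_of_factor (hξ.prodMk (hη.prodMk hζm)) fun x y => by simp +contextual
  linarith

variable {f : X → X}

lemma measurable_ordIdx (hf : Measurable f) (d l : ℕ) : Measurable (ordIdx f d l) := by
  unfold ordIdx
  simp_rw [Finset.card_filter]
  refine Finset.measurable_fun_sum _ fun r _ => Measurable.ite ?_ measurable_const measurable_const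
  change MeasurableSet {x | (f^[d - r] x : ℝ) ≤ (f^[d - l] x : ℝ)}
  exact measurableSet_le (hf.iterate _).subtype_val (hf.iterate _).subtype_val

lemma ordIdx_lt (f : X → X) (d l : ℕ) (x : X) : ordIdx f d l x < l + 1 :=
  Nat.lt_succ_of_le ((Finset.card_filter_le _ _).trans_eq (Finset.card_range l))

/-- The ordinal pattern of order `d` realized by a point. -/
def ordPattern (f : X → X) (d : ℕ) (x : X) (l : Fin d) : Fin (l.val + 2) :=
  ⟨ordIdx f d (l.val + 1) x, ordIdx_lt f d _ x⟩

lemma measurable_ordPattern (hf : Measurable f) (d : ℕ) : Measurable (ordPattern f d) := by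
  refine measurable_pi_lambda _ fun l => measurable_to_countable fun x => ?_
  have : (fun x => ordPattern f d x l) ⁻¹' {ordPattern f d x l} =
      ordIdx f d (l.val + 1) ⁻¹' {ordIdx f d (l.val + 1) x} := by
    ext y
    simp [ordPattern]
  rw [this]
  exact measurable_ordIdx hf _ _ (measurableSet_singleton _)

lemma ordIdx_eq_of_ordPattern_eq {d : ℕ} {x y : X} (h : ordPattern f d x = ordPattern f d y) :
    ordIdx f d d x = ordIdx f d d y := by
  cases d with
  | zero => simp [ordIdx]
  | succ d => exact congrArg Fin.val (congrFun h (Fin.last d))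

lemma isFibrePartition_patPartition (f : X → X) (d : ℕ) :
    IsFibrePartition (patPartition f d) (ordPattern f d) := by
  have hfib : ∀ i : (∀ l : Fin d, Fin (l.val + 2)),
      {x : X | ∀ l : Fin d, ordIdx f d (l.val + 1) x = (i l).val} = ordPattern f d ⁻¹' {i} := by
    intro i
    ext x
    simp [funext_iff, ordPattern, Fin.ext_iff]
  constructor
  · intro A hA x hx
    obtain ⟨i, -, rfl⟩ := Finset.mem_image.1 hA
    simp only [hfib] at hx ⊢
    rw [← show ordPattern f d x = i from hx]
  · intro x
    exact Finset.mem_image.2 ⟨ordPattern f d x, Finset.mem_univ _, hfib _⟩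

end Partitions

section MeanErgodic

variable {Ω : Type*} [MeasurableSpace Ω] {μ : Measure Ω} [IsProbabilityMeasure μ] {f : Ω → Ω}

/-- The mean ergodic theorem for the indicator of a measurable set, in measure. -/
lemma Ergodic.tendstoInMeasure_birkhoffAverage_indicator (hf : Ergodic f μ) {B : Set Ω}
    (hB : MeasurableSet B) :
    TendstoInMeasure μ (fun d => birkhoffAverage ℝ f (B.indicator fun _ => (1 : ℝ)) d) atTop
      (fun _ => μ.real B) := by
  have hmp := hf.toMeasurePreserving
  set U : Lp ℝ 2 μ →L[ℝ] Lp ℝ 2 μ :=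
    (Lp.compMeasurePreservingₗᵢ ℝ f hmp).toContinuousLinearMap with hU
  have hUapp : ∀ g, U g = Lp.compMeasurePreserving f hmp g := fun _ => rfl
  have hUnorm : ‖U‖ ≤ 1 := LinearIsometry.norm_toContinuousLinearMap_le _
  set g : Lp ℝ 2 μ := indicatorConstLp 2 hB (measure_ne_top μ B) (1 : ℝ) with hg
  set o : Lp ℝ 2 μ := indicatorConstLp 2 MeasurableSet.univ (measure_ne_top μ univ) (1 : ℝ) with ho
  have hlim := U.tendsto_birkhoffAverage_orthogonalProjection hUnorm g
  set P := (U.eqLocus (1 : Lp ℝ 2 μ →L[ℝ] Lp ℝ 2 μ)).orthogonalProjectionOnto g with hP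
  have hfix : U (P : Lp ℝ 2 μ) = P := P.2
  have hofix : U o = o := by
    rw [hUapp, ho, Lp.indicatorConstLp_compMeasurePreserving]
    rfl
  obtain ⟨c, hc⟩ : ∃ c, (P : Lp ℝ 2 μ) =ᵐ[μ] const Ω c := by
    refine hf.ae_eq_const_of_ae_eq_comp_ae (Lp.aestronglyMeasurable _) ?_
    have h := Lp.coeFn_compMeasurePreserving (P : Lp ℝ 2 μ) hmp
    rw [← hUapp, hfix] at h
    exact h.symm
  have hcB : c = μ.real B := by
    have h := Submodule.inner_orthogonalProjectionOnto_eq_of_mem_left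
      (K := U.eqLocus (1 : Lp ℝ 2 μ →L[ℝ] Lp ℝ 2 μ)) ⟨o, hofix⟩ g
    rw [← hP, Submodule.coe_inner] at h
    simp only [ho, L2.inner_indicatorConstLp_one, Measure.restrict_univ] at h
    rw [integral_congr_ae hc, integral_congr_ae indicatorConstLp_coeFn,
      integral_indicator_const _ hB] at h
    simpa using h
  have hiter : ∀ k, (U^[k] g : Lp ℝ 2 μ) =ᵐ[μ] fun x => B.indicator (fun _ => (1 : ℝ)) (f^[k] x) := by
    intro k
    have h1 : U^[k] g = Lp.compMeasurePreserving f^[k] (hmp.iterate k) g := by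
      rw [← Lp.compMeasurePreserving_iterate hmp k]
      rfl
    rw [h1]
    refine (Lp.coeFn_compMeasurePreserving g (hmp.iterate k)).trans ?_
    exact (hmp.iterate k).quasiMeasurePreserving.ae_eq_comp indicatorConstLp_coeFn
  refine (tendstoInMeasure_of_tendsto_Lp hlim).congr (fun d => ?_) ?_
  · have h1 : ∀ᵐ x ∂μ, ∀ k, (U^[k] g : Lp ℝ 2 μ) x = B.indicator (fun _ => (1 : ℝ)) (f^[k] x) :=
      ae_all_iff.2 hiter
    simp only [birkhoffAverage, birkhoffSum, _root_.id]
    filter_upwards [h1, Lp.coeFn_smul (d : ℝ)⁻¹ (∑ k ∈ Finset.range d, U^[k] g),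
      Lp.coeFn_finsetSum (Finset.range d) (fun k => U^[k] g)] with x hx1 hx2 hx3
    rw [hx2, Pi.smul_apply, hx3, Finset.sum_apply]
    simp only [hx1]
    rfl
  · rw [← hcB]
    exact hc

/-- The frequency of visits to `B` at the times `1, …, d` tends to `μ B` in measure. -/
lemma Ergodic.tendsto_measureReal_card_visits (hf : Ergodic f μ) {B : Set Ω}
    (hB : MeasurableSet B) {ε : ℝ} (hε : 0 < ε) :
    Tendsto (fun d : ℕ => μ.real {x | ε ≤
      |(((Finset.range d).filter fun r => f^[d - r] x ∈ B).card : ℝ) / d - μ.real B|})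
      atTop (𝓝 0) := by
  have h := tendstoInMeasure_iff_measureReal_norm.1
    (hf.tendstoInMeasure_birkhoffAverage_indicator hB) ε hε
  refine h.congr fun d => ?_
  have hmeas : Measurable (birkhoffAverage ℝ f (B.indicator fun _ => (1 : ℝ)) d) := by
    unfold birkhoffAverage birkhoffSum
    refine (Finset.measurable_fun_sum (Finset.range d) fun k _ => ?_).const_smul (d : ℝ)⁻¹
    exact (measurable_const.indicator hB).comp (hf.measurable.iterate k)
  have hset : MeasurableSet {x | ε ≤
      ‖birkhoffAverage ℝ f (B.indicator fun _ => (1 : ℝ)) d x - μ.real B‖} :=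
    measurableSet_le measurable_const (hmeas.sub_const _).norm
  rw [← hf.toMeasurePreserving.measureReal_preimage hset.nullMeasurableSet]
  congr 1
  ext x
  have hcount : birkhoffAverage ℝ f (B.indicator fun _ => (1 : ℝ)) d (f x) =
      (((Finset.range d).filter fun r => f^[d - r] x ∈ B).card : ℝ) / d := by
    rw [birkhoffAverage, birkhoffSum, smul_eq_mul, inv_mul_eq_div, Finset.card_filter,
      Nat.cast_sum, ← Finset.sum_range_reflect]
    congr 1
    refine Finset.sum_congr rfl fun r hr => ?_
    have : d - r = d - 1 - r + 1 := by have := Finset.mem_range.1 hr; omega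
    rw [this, Function.iterate_succ_apply]
    by_cases hx : f^[d - 1 - r] (f x) ∈ B <;> simp [hx]
  simp [hcount, Real.norm_eq_abs]

end MeanErgodic

section Approximation

/-- The set `B` is approximated in measure by sets of the form `(N d)⁻¹ C` as `d → ∞`. -/
def IsAsymptoticallyDetermined {Ω κ : Type*} [MeasurableSpace Ω] (μ : Measure Ω)
    (N : ℕ → Ω → κ) (B : Set Ω) : Prop :=
  ∀ ε > 0, ∀ᶠ d in atTop, ∃ C : Set κ, μ.real {x | ¬(x ∈ B ↔ N d x ∈ C)} < ε

namespace IsAsymptoticallyDetermined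

variable {Ω κ : Type*} [MeasurableSpace Ω] {μ : Measure Ω} {N : ℕ → Ω → κ}

lemma empty : IsAsymptoticallyDetermined μ N ∅ := fun ε hε =>
  Eventually.of_forall fun _ => ⟨∅, by simpa using hε⟩

lemma compl {B : Set Ω} (h : IsAsymptoticallyDetermined μ N B) :
    IsAsymptoticallyDetermined μ N Bᶜ := fun ε hε =>
  (h ε hε).mono fun d ⟨C, hC⟩ => ⟨Cᶜ, by simpa only [mem_compl_iff, not_iff_not] using hC⟩

variable [IsProbabilityMeasure μ]

lemma union {A B : Set Ω} (hA : IsAsymptoticallyDetermined μ N A)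
    (hB : IsAsymptoticallyDetermined μ N B) : IsAsymptoticallyDetermined μ N (A ∪ B) := by
  intro ε hε
  filter_upwards [hA (ε / 2) (half_pos hε), hB (ε / 2) (half_pos hε)] with d ⟨C, hC⟩ ⟨D, hD⟩
  refine ⟨C ∪ D, ?_⟩
  have hsub : {x | ¬(x ∈ A ∪ B ↔ N d x ∈ C ∪ D)} ⊆
      {x | ¬(x ∈ A ↔ N d x ∈ C)} ∪ {x | ¬(x ∈ B ↔ N d x ∈ D)} := by
    intro x
    simp only [mem_union, mem_ofPred_eq]
    tauto
  linarith [(measureReal_mono (μ := μ) hsub).trans (measureReal_union_le _ _)]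

lemma iUnion {B : ℕ → Set Ω} (hm : ∀ n, MeasurableSet (B n))
    (h : ∀ n, IsAsymptoticallyDetermined μ N (B n)) :
    IsAsymptoticallyDetermined μ N (⋃ n, B n) := by
  intro ε hε
  have hacc : ∀ n, IsAsymptoticallyDetermined μ N (accumulate B n) := by
    intro n
    induction n with
    | zero => simpa [accumulate_zero_nat] using h 0
    | succ n ih => rw [accumulate_succ]; exact ih.union (h _)
  have hmacc : ∀ n, MeasurableSet (accumulate B n) := fun n => by
    unfold accumulate
    exact MeasurableSet.biUnion (to_countable _) fun k _ => hm k
  have hsubacc : ∀ n, accumulate B n ⊆ ⋃ n, B n := fun n => accumulate_subset_iUnion n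
  have hlim : Tendsto (fun n => μ.real (accumulate B n)) atTop (𝓝 (μ.real (⋃ n, B n))) :=
    (ENNReal.tendsto_toReal (measure_ne_top _ _)).comp tendsto_measure_iUnion_accumulate
  obtain ⟨n, hn⟩ := (hlim.eventually_const_lt
    (show μ.real (⋃ n, B n) - ε / 2 < μ.real (⋃ n, B n) by linarith)).exists
  filter_upwards [hacc n (ε / 2) (half_pos hε)] with d ⟨C, hC⟩
  refine ⟨C, ?_⟩
  have hsub : {x | ¬(x ∈ ⋃ n, B n ↔ N d x ∈ C)} ⊆
      {x | ¬(x ∈ accumulate B n ↔ N d x ∈ C)} ∪ ((⋃ n, B n) \ accumulate B n) := by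
    intro x
    have := @hsubacc n x
    simp only [mem_union, mem_ofPred_eq, Set.mem_sdiff]
    tauto
  have h1 := (measureReal_mono (μ := μ) hsub).trans (measureReal_union_le _ _)
  rw [measureReal_sdiff (hsubacc n) (hmacc n)] at h1
  linarith

lemma exists_map_measureReal_ne_lt {ι : Type*} [Fintype ι] {ξ : Ω → ι}
    (h : ∀ i, IsAsymptoticallyDetermined μ N (ξ ⁻¹' {i})) {δ : ℝ} (hδ : 0 < δ) :
    ∀ᶠ d in atTop, ∃ φ : κ → ι, μ.real {x | ξ x ≠ φ (N d x)} < δ := by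
  obtain ⟨x₀⟩ : Nonempty Ω := nonempty_of_isProbabilityMeasure μ
  have hcard : (0 : ℝ) < Fintype.card ι := Nat.cast_pos.2 (Fintype.card_pos_iff.2 ⟨ξ x₀⟩)
  filter_upwards [eventually_all.2 fun i => h i (δ / Fintype.card ι) (div_pos hδ hcard)] with d hd
  choose C hC using hd
  refine ⟨fun k => if hk : ∃ i, k ∈ C i then hk.choose else ξ x₀, ?_⟩
  have hsub : {x | ξ x ≠ (fun k => if hk : ∃ i, k ∈ C i then hk.choose else ξ x₀) (N d x)} ⊆
      ⋃ i, {x | ¬(x ∈ ξ ⁻¹' {i} ↔ N d x ∈ C i)} := by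
    intro x hx
    by_contra hcon
    simp only [mem_iUnion, mem_ofPred_eq, not_exists, not_not, mem_preimage,
      mem_singleton_iff] at hcon
    have hk : ∃ i, N d x ∈ C i := ⟨ξ x, (hcon _).1 rfl⟩
    refine hx ?_
    simp only [dif_pos hk]
    exact (hcon _).2 hk.choose_spec
  refine ((measureReal_mono hsub).trans (measureReal_iUnion_fintype_le _)).trans_lt ?_
  refine (Finset.sum_lt_sum_of_nonempty ⟨ξ x₀, Finset.mem_univ _⟩ fun i _ => hC i).trans_eq ?_
  rw [Finset.sum_const, Finset.card_univ, nsmul_eq_mul]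
  field_simp

end IsAsymptoticallyDetermined

/-- To the right of `a`, a finite measure on `ℝ` charges some `(a, b]` of which only the
endpoint `b` may carry large mass. -/
lemma exists_Ioc_pos_Ioo_lt (ν : Measure ℝ) [IsFiniteMeasure ν] {a : ℝ} (ha : ν (Ioi a) ≠ 0)
    {ε : ℝ≥0∞} (hε : 0 < ε) : ∃ b, ν (Ioc a b) ≠ 0 ∧ ν (Ioo a b) < ε := by
  set U := {b | ν (Ioc a b) ≠ 0} with hU
  have hUne : U.Nonempty := by
    by_contra hne
    rw [not_nonempty_iff_eq_empty] at hne
    refine ha (measure_mono_null (t := ⋃ n : ℕ, Ioc a (n : ℝ)) ?_ (measure_iUnion_null fun n => ?_))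
    · intro x hx
      obtain ⟨n, hn⟩ := exists_nat_ge x
      exact mem_iUnion.2 ⟨n, hx, hn⟩
    · by_contra h
      exact (hne ▸ (show (n : ℝ) ∈ U from h) : (n : ℝ) ∈ (∅ : Set ℝ))
  have hUa : ∀ b ∈ U, a < b := fun b hb => by
    by_contra h
    exact hb (by simp [Ioc_eq_empty h])
  have hbdd : BddBelow U := ⟨a, fun b hb => (hUa b hb).le⟩
  set c := sInf U with hc
  have hac : a ≤ c := le_csInf hUne fun b hb => (hUa b hb).le
  have hlow : ∀ b, b < c → ν (Ioc a b) = 0 := fun b hb => by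
    by_contra h
    exact (csInf_le hbdd (show b ∈ U from h)).not_gt hb
  have hup : ∀ b, c < b → ν (Ioc a b) ≠ 0 := fun b hb h => by
    obtain ⟨b', hb', hlt⟩ := exists_lt_of_csInf_lt hUne hb
    exact hb' (measure_mono_null (Ioc_subset_Ioc_right hlt.le) h)
  have hIoo : ν (Ioo a c) = 0 := by
    obtain ⟨u, -, hu, hlim⟩ := exists_seq_strictMono_tendsto c
    refine measure_mono_null (t := ⋃ n, Ioc a (u n)) ?_ (measure_iUnion_null fun n => hlow _ (hu n))
    intro x hx
    obtain ⟨n, hn⟩ := (hlim.eventually_const_lt hx.2).exists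
    exact mem_iUnion.2 ⟨n, hx.1, hn.le⟩
  by_cases hcU : ν (Ioc a c) = 0
  · obtain ⟨u, hanti, hu, hlim⟩ := exists_seq_strictAnti_tendsto c
    have hempty : ⋂ n, Ioo c (u n) = ∅ := by
      refine eq_empty_of_forall_notMem fun x hx => ?_
      rw [mem_iInter] at hx
      obtain ⟨n, hn⟩ := (hlim.eventually_lt_const (hx 0).1).exists
      exact (hx n).2.not_gt hn
    have ht := tendsto_measure_iInter_atTop (μ := ν) (s := fun n => Ioo c (u n))
      (fun n => measurableSet_Ioo.nullMeasurableSet)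
      (fun m n hmn => Ioo_subset_Ioo_right (hanti.antitone hmn)) ⟨0, measure_ne_top _ _⟩
    rw [hempty, measure_empty] at ht
    obtain ⟨n, hn⟩ := (ht.eventually_lt_const hε).exists
    refine ⟨u n, hup _ (hu n), ?_⟩
    have hsub : Ioo a (u n) ⊆ Ioc a c ∪ Ioo c (u n) := fun x hx =>
      (le_or_gt x c).imp (fun h => ⟨hx.1, h⟩) fun h => ⟨h, hx.2⟩
    calc ν (Ioo a (u n)) ≤ ν (Ioc a c) + ν (Ioo c (u n)) :=
          (measure_mono hsub).trans (measure_union_le _ _)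
      _ < ε := by rwa [hcU, zero_add]
  · exact ⟨c, hcU, by rwa [hIoo]⟩

variable {X : Set ℝ} {f : X → X} {μ : Measure X} [IsProbabilityMeasure μ]

lemma isAsymptoticallyDetermined_Iic (hf : Ergodic f μ) (a : ℝ) :
    IsAsymptoticallyDetermined μ (fun d => ordIdx f d d) (Subtype.val ⁻¹' Iic a) := by
  intro ε hε
  have hval : Measurable (Subtype.val : X → ℝ) := measurable_subtype_coe
  set ν := μ.map (Subtype.val : X → ℝ)
  have : IsFiniteMeasure ν := inferInstance
  by_cases ha : ν (Ioi a) = 0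
  · refine Eventually.of_forall fun d => ⟨univ, ?_⟩
    rw [Measure.map_apply hval measurableSet_Ioi] at ha
    have : {x : X | ¬(x ∈ Subtype.val ⁻¹' Iic a ↔ ordIdx f d d x ∈ univ)} =
        Subtype.val ⁻¹' Ioi a := by
      ext x
      simp
    rw [this, measureReal_def, ha]
    simpa using hε
  obtain ⟨b, hb, hIoo⟩ := exists_Ioc_pos_Ioo_lt ν ha (ε := ENNReal.ofReal (ε / 2)) (by simpa)
  have hab : a < b := by
    by_contra h
    exact hb (by simp [Ioc_eq_empty h])
  rw [Measure.map_apply hval measurableSet_Ioc] at hb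
  rw [Measure.map_apply hval measurableSet_Ioo] at hIoo
  have hIoo' : μ.real (Subtype.val ⁻¹' Ioo a b) < ε / 2 :=
    (ENNReal.lt_ofReal_iff_toReal_lt (measure_ne_top _ _)).1 hIoo
  have hA : MeasurableSet (Subtype.val ⁻¹' Iic a : Set X) := hval measurableSet_Iic
  have hB : MeasurableSet (Subtype.val ⁻¹' Iic b : Set X) := hval measurableSet_Iic
  have hlt : μ.real (Subtype.val ⁻¹' Iic a : Set X) < μ.real (Subtype.val ⁻¹' Iic b : Set X) := by
    have h0 : (Subtype.val ⁻¹' Iic b : Set X) = Subtype.val ⁻¹' Iic a ∪ Subtype.val ⁻¹' Ioc a b := by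
      rw [← preimage_union, Iic_union_Ioc_eq_Iic hab.le]
    have h1 : Disjoint (Subtype.val ⁻¹' Iic a : Set X) (Subtype.val ⁻¹' Ioc a b) :=
      (Iic_disjoint_Ioc le_rfl).preimage _
    rw [h0, measureReal_union h1 (hval measurableSet_Ioc)]
    have h2 : 0 < μ.real (Subtype.val ⁻¹' Ioc a b : Set X) :=
      ENNReal.toReal_pos hb (measure_ne_top _ _)
    linarith
  set Fa := μ.real (Subtype.val ⁻¹' Iic a : Set X)
  set Fb := μ.real (Subtype.val ⁻¹' Iic b : Set X)
  set m := (Fa + Fb) / 2 with hm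
  have hη : 0 < (Fb - Fa) / 2 := by linarith
  filter_upwards [(hf.tendsto_measureReal_card_visits hA hη).eventually_lt_const
      (show 0 < ε / 4 by linarith),
    (hf.tendsto_measureReal_card_visits hB hη).eventually_lt_const
      (show 0 < ε / 4 by linarith)] with d hda hdb
  refine ⟨{k | (k : ℝ) / d < m}, ?_⟩
  set Ea : Set X := {x | (Fb - Fa) / 2 ≤ |(((Finset.range d).filter fun r =>
    f^[d - r] x ∈ Subtype.val ⁻¹' Iic a).card : ℝ) / d - Fa|}
  set Eb : Set X := {x | (Fb - Fa) / 2 ≤ |(((Finset.range d).filter fun r =>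
    f^[d - r] x ∈ Subtype.val ⁻¹' Iic b).card : ℝ) / d - Fb|}
  have hsub : {x | ¬(x ∈ Subtype.val ⁻¹' Iic a ↔ ordIdx f d d x ∈ {k : ℕ | (k : ℝ) / d < m})} ⊆
      (Ea ∪ Eb) ∪ Subtype.val ⁻¹' Ioo a b := by
    intro x hx
    by_contra hcon
    simp only [mem_union, not_or, Ea, Eb, mem_ofPred_eq, not_le, abs_lt] at hcon
    obtain ⟨⟨⟨-, h1⟩, h2, -⟩, h3⟩ := hcon
    refine hx ?_
    simp only [mem_preimage, mem_Iic, mem_ofPred_eq]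
    constructor
    · intro hxa
      have hle : ordIdx f d d x ≤ ((Finset.range d).filter fun r =>
          f^[d - r] x ∈ (Subtype.val ⁻¹' Iic a : Set X)).card := by
        refine Finset.card_le_card fun r hr => ?_
        simp only [Finset.mem_filter, Nat.sub_self, Function.iterate_zero, _root_.id] at hr ⊢
        exact ⟨hr.1, le_trans (Subtype.coe_le_coe.2 hr.2) hxa⟩
      have := div_le_div_of_nonneg_right (Nat.cast_le (α := ℝ).2 hle) d.cast_nonneg
      linarith
    · intro hlow
      by_contra hxa
      have hbx : b ≤ x := by
        by_contra hxb
        exact h3 ⟨not_le.1 hxa, not_le.1 hxb⟩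
      have hle : ((Finset.range d).filter fun r =>
          f^[d - r] x ∈ (Subtype.val ⁻¹' Iic b : Set X)).card ≤ ordIdx f d d x := by
        refine Finset.card_le_card fun r hr => ?_
        simp only [Finset.mem_filter, Nat.sub_self, Function.iterate_zero, _root_.id] at hr ⊢
        exact ⟨hr.1, Subtype.coe_le_coe.1 (le_trans hr.2 hbx)⟩
      have := div_le_div_of_nonneg_right (Nat.cast_le (α := ℝ).2 hle) d.cast_nonneg
      linarith
  have h1 := (measureReal_mono (μ := μ) hsub).trans (measureReal_union_le _ _)
  have h2 := measureReal_union_le (μ := μ) Ea Eb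
  linarith

lemma isAsymptoticallyDetermined_of_measurableSet (hf : Ergodic f μ) {B : Set X}
    (hB : MeasurableSet B) : IsAsymptoticallyDetermined μ (fun d => ordIdx f d d) B := by
  obtain ⟨S, hS, rfl⟩ := hB
  rw [BorelSpace.measurable_eq (α := ℝ), borel_eq_generateFrom_Iic ℝ] at hS
  refine MeasurableSpace.generateFrom_induction (range Iic)
    (fun S _ => IsAsymptoticallyDetermined μ (fun d => ordIdx f d d) (Subtype.val ⁻¹' S))
    ?_ ?_ ?_ ?_ S hS
  · rintro _ ⟨a, rfl⟩ _
    exact isAsymptoticallyDetermined_Iic hf a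
  · exact .empty
  · exact fun _ _ h => h.compl
  · intro s hs h
    rw [preimage_iUnion]
    refine .iUnion (fun n => ?_) h
    refine measurable_subtype_coe ?_
    rw [BorelSpace.measurable_eq (α := ℝ), borel_eq_generateFrom_Iic ℝ]
    exact hs n

lemma eventually_dynEntropy_le_add (hf : Ergodic f μ) {𝒜 : Finset (Set X)}
    (h𝒜 : IsFinPartition 𝒜) {ε : ℝ} (hε : 0 < ε) :
    ∀ᶠ d in atTop, dynEntropy μ f 𝒜 ≤ dynEntropy μ f (patPartition f d) + ε := by
  obtain ⟨ξ, hξ, hfib⟩ := h𝒜.exists_isFibrePartition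
  obtain ⟨δ, hδ, hclose⟩ := exists_fibreEntropy_pair_sub_lt (μ := μ) hξ hε
  filter_upwards [IsAsymptoticallyDetermined.exists_map_measureReal_ne_lt (fun i =>
    isAsymptoticallyDetermined_of_measurableSet hf (hξ (measurableSet_singleton i))) hδ]
    with d ⟨φ, hφ⟩
  have h1 := hclose (fun x => φ (ordIdx f d d x)) hφ
  have hη := measurable_ordPattern hf.measurable d
  have h2 := fibreEntropy_pair_sub_le_of_factor (μ := μ) (ζ := fun x => φ (ordIdx f d d x)) hξ hη
    fun x y h => congrArg φ (ordIdx_eq_of_ordPattern_eq h)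
  have h3 := dynEntropy_le_add hf.toMeasurePreserving hξ hη hfib (isFibrePartition_patPartition f d)
  linarith

end Approximation

/-- For an ergodic system, the Kolmogorov-Sinai entropy is the limit (and the supremum)
of the entropies `h_μ(f, P_d)` of the ordinal pattern partitions. -/
theorem ksEntropy_eq_limit_ordinal_ergodic
    {X : Set ℝ} (f : X → X) (μ : Measure X) [IsProbabilityMeasure μ]
    (hf : Ergodic f μ) :
    Tendsto (fun d : ℕ => ENNReal.ofReal (dynEntropy μ f (patPartition f d)))
      atTop (nhds (ksEntropy μ f)) ∧
    ksEntropy μ f = ⨆ d : ℕ, ENNReal.ofReal (dynEntropy μ f (patPartition f d)) := by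
  have hle : ∀ d, ENNReal.ofReal (dynEntropy μ f (patPartition f d)) ≤ ksEntropy μ f := fun d =>
    le_iSup₂ (f := fun (𝒜 : Finset (Set X)) (_ : IsFinPartition 𝒜) =>
      ENNReal.ofReal (dynEntropy μ f 𝒜)) (patPartition f d)
      ((isFibrePartition_patPartition f d).isFinPartition (measurable_ordPattern hf.measurable d))
  have hlim : Tendsto (fun d : ℕ => ENNReal.ofReal (dynEntropy μ f (patPartition f d)))
      atTop (nhds (ksEntropy μ f)) := by
    refine tendsto_order.2 ⟨fun b hb => ?_, fun b hb => Eventually.of_forall fun d =>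
      (hle d).trans_lt hb⟩
    simp only [ksEntropy, lt_iSup_iff] at hb
    obtain ⟨𝒜, h𝒜, hb⟩ := hb
    have hb' := (ENNReal.lt_ofReal_iff_toReal_lt hb.ne_top).1 hb
    filter_upwards [eventually_dynEntropy_le_add hf h𝒜 (half_pos (sub_pos.2 hb'))] with d hd
    exact (ENNReal.lt_ofReal_iff_toReal_lt hb.ne_top).2 (by linarith)
  exact ⟨hlim, le_antisymm (le_of_tendsto' hlim fun d =>
    le_iSup (fun d : ℕ => ENNReal.ofReal (dynEntropy μ f (patPartition f d))) d) (iSup_le hle)⟩
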